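/- Fix τ ∈ [0,1). Define Q(x,y) = -(1/n)·log(4y²·erfc(c_n·y)) + (x² - y²)/(1+τ) - ∫_ℝ log((x-t)² + y²) dρ_sc(t) where c_n = √(2n/(1-τ²)) and ρ_sc is the semicircle density t ↦ √(2(1+τ) - t²)/(π(1+τ)) on |t| ≤ √(2(1+τ)). Then for each fixed y > 0 and n, the function x ↦ Q(x,y) is even in x and ∂Q/∂x > 0 for all x > 0; in particular, for fixed y > 0 the minimum over x is attained at x = 0. -/

import Mathlib

open Real MeasureTheory

/-- The complementary error function. -/
noncomputable def erfc (t : ℝ) : ℝ :=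
  (2 / Real.sqrt π) * ∫ s in Set.Ioi t, Real.exp (-s ^ 2)

/-- The semicircle density of the elliptic GinOE. -/
noncomputable def rhoSC (τ : ℝ) (t : ℝ) : ℝ :=
  if t ^ 2 ≤ 2 * (1 + τ) then Real.sqrt (2 * (1 + τ) - t ^ 2) / (π * (1 + τ)) else 0

/-- The approximated potential `Q_n^{(0)}(x + iy)`. -/
noncomputable def Qpot (τ : ℝ) (n : ℕ) (x y : ℝ) : ℝ :=
  -(1 / n) * Real.log (4 * y ^ 2 * erfc (Real.sqrt (2 * n / (1 - τ ^ 2)) * y)) +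
    (x ^ 2 - y ^ 2) / (1 + τ) -
    ∫ t : ℝ, Real.log ((x - t) ^ 2 + y ^ 2) * rhoSC τ t

/-- The complex Poisson-type integral `∫₀^π sin² θ / (1 - 2 r cos θ + r²) dθ = π / 2` for
`‖r‖ < 1`. -/
theorem integral_sin_sq_div_one_sub_two_mul_cos_add_sq {r : ℂ} (hr : ‖r‖ < 1) :
    ∫ θ in (0 : ℝ)..π, ((Real.sin θ : ℂ) ^ 2 / (1 - 2 * r * (Real.cos θ : ℂ) + r ^ 2)) =
      (π : ℂ) / 2 := by
  have hne : ∀ w : ℂ, ‖w‖ ≤ 1 → 1 - r * w ≠ 0 := by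
    intro w hw h
    have h1 : r * w = 1 := (sub_eq_zero.mp h).symm
    have h2 : ‖r‖ * ‖w‖ = 1 := by rw [← norm_mul, h1, norm_one]
    nlinarith [norm_nonneg r, norm_nonneg w]
  set g : ℂ → ℂ := fun w ↦ (1 - w ^ 2) / (4 * (1 - r * w)) with hg
  have hgd : DifferentiableOn ℂ g (Metric.closedBall 0 1) := by
    intro w hw
    have hw' : 4 * (1 - r * w) ≠ 0 :=
      mul_ne_zero (by norm_num) (hne w (by simpa using hw))
    refine DifferentiableAt.differentiableWithinAt ?_
    exact DifferentiableAt.div (by fun_prop) (by fun_prop) hw'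
  have hmean : ∫ θ in (0 : ℝ)..2 * π, g (circleMap 0 1 θ) = (π : ℂ) / 2 := by
    have h := DiffContOnCl.circleAverage (f := g) (c := 0) (R := 1)
      (by
        refine DifferentiableOn.diffContOnCl ?_
        exact hgd.mono (by simpa using Metric.closure_ball_subset_closedBall))
    rw [circleAverage_def, inv_smul_eq_iff₀ (by positivity)] at h
    rw [h]
    simp [hg]
    ring
  have hcont : Continuous fun θ : ℝ ↦ g (circleMap 0 1 θ) := by
    refine hgd.continuousOn.comp_continuous (continuous_circleMap 0 1) fun θ ↦ ?_
    simp [circleMap_zero]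
  have hrefl : ∫ θ in (0 : ℝ)..π, g (circleMap 0 1 (2 * π - θ)) =
      ∫ θ in π..2 * π, g (circleMap 0 1 θ) := by
    rw [intervalIntegral.integral_comp_sub_left (fun θ ↦ g (circleMap 0 1 θ))]
    congr 1 <;> ring
  have hpt : ∀ θ : ℝ, (Real.sin θ : ℂ) ^ 2 / (1 - 2 * r * (Real.cos θ : ℂ) + r ^ 2) =
      g (circleMap 0 1 θ) + g (circleMap 0 1 (2 * π - θ)) := by
    intro θ
    have hc1 : circleMap 0 1 θ = Complex.cos θ + Complex.sin θ * Complex.I := by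
      simp [circleMap_zero, Complex.exp_mul_I]
    have hc2 : circleMap 0 1 (2 * π - θ) = Complex.cos θ - Complex.sin θ * Complex.I := by
      simp [circleMap_zero, Complex.exp_mul_I, Complex.cos_two_pi_sub, Complex.sin_two_pi_sub]
      ring
    have hn1 := hne (circleMap 0 1 θ) (by simp [circleMap_zero])
    have hn2 := hne (circleMap 0 1 (2 * π - θ)) (by simp only [norm_circleMap_zero]; simp)
    have hsc := Complex.sin_sq_add_cos_sq (θ : ℂ)
    rw [hc1] at hn1
    rw [hc2] at hn2
    simp only [hg, hc1, hc2, Complex.ofReal_sin, Complex.ofReal_cos]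
    generalize Complex.sin (θ : ℂ) = s at *
    generalize Complex.cos (θ : ℂ) = c at *
    have hI := Complex.I_sq
    have hD : 1 - 2 * r * c + r ^ 2 =
        (1 - r * (c + s * Complex.I)) * (1 - r * (c - s * Complex.I)) := by
      linear_combination (-r ^ 2) * hsc + r ^ 2 * s ^ 2 * hI
    rw [hD, div_add_div _ _ (by simp [hn1]) (by simp [hn2]),
      div_eq_div_iff (mul_ne_zero hn1 hn2) (by simp [hn1, hn2])]
    have key : (1 - (c + s * Complex.I) ^ 2) * (1 - r * (c - s * Complex.I)) +
        (1 - r * (c + s * Complex.I)) * (1 - (c - s * Complex.I) ^ 2) = 4 * s ^ 2 := by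
      have hef : (c + s * Complex.I) * (c - s * Complex.I) = 1 := by
        linear_combination hsc - s ^ 2 * hI
      linear_combination (2 * r * c - 2) * hef - 4 * s ^ 2 * hI
    linear_combination (-4 * (1 - r * (c + s * Complex.I)) * (1 - r * (c - s * Complex.I))) * key
  have hi : ∀ a b : ℝ, IntervalIntegrable (fun θ ↦ g (circleMap 0 1 θ)) volume a b :=
    fun a b ↦ hcont.intervalIntegrable a b
  have hi2 : IntervalIntegrable (fun θ ↦ g (circleMap 0 1 (2 * π - θ))) volume 0 π :=
    (hcont.comp (by fun_prop : Continuous fun θ : ℝ ↦ 2 * π - θ)).intervalIntegrable _ _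
  simp_rw [hpt]
  rw [intervalIntegral.integral_add (hi _ _) hi2, hrefl,
    intervalIntegral.integral_add_adjacent_intervals (hi _ _) (hi _ _), hmean]

/-- Every non-real `z` is `(R / 2) (r + 1 / r)` for some `r` in the punctured unit disc. -/
theorem exists_joukowsky_preimage {R : ℝ} (hR : 0 < R) {z : ℂ} (hz : z.im ≠ 0) :
    ∃ r : ℂ, r ≠ 0 ∧ ‖r‖ < 1 ∧ z = R / 2 * (r + r⁻¹) := by
  have hRc : (R : ℂ) ≠ 0 := by exact_mod_cast hR.ne'
  obtain ⟨s, hs⟩ :=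
    IsAlgClosed.exists_pow_nat_eq (z ^ 2 - R ^ 2) (n := 2) (by norm_num)
  set p := (z + s) / R with hp
  have hprod : p * ((z - s) / R) = 1 := by
    rw [hp]; field_simp; linear_combination -hs
  have hp0 : p ≠ 0 := left_ne_zero_of_mul_eq_one hprod
  have hinv : p⁻¹ = (z - s) / R := inv_eq_of_mul_eq_one_right hprod
  have hzp : z = R / 2 * (p + p⁻¹) := by
    rw [hinv, hp]; field_simp; ring
  rcases lt_trichotomy ‖p‖ 1 with h | h | h
  · exact ⟨p, hp0, h, hzp⟩
  · exfalso
    apply hz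
    rw [hzp, Complex.inv_eq_conj h, Complex.add_conj]
    simp
  · refine ⟨p⁻¹, inv_ne_zero hp0, ?_, by rw [inv_inv, add_comm]; exact hzp⟩
    rw [norm_inv]
    exact inv_lt_one_of_one_lt₀ h

/-- In angular coordinates, the real part of the Stieltjes transform of the semicircle law on
`[-R, R]` is strictly below its value `2 x / R²` at the real axis. -/
theorem integral_semicircle_kernel_lt {R x y : ℝ} (hR : 0 < R) (hx : 0 < x) (hy : 0 < y) :
    ∫ θ in (0 : ℝ)..π, (x - R * Real.cos θ) / ((x - R * Real.cos θ) ^ 2 + y ^ 2) *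
      Real.sin θ ^ 2 < π * x / R ^ 2 := by
  obtain ⟨r, hr0, hr1, hz⟩ := exists_joukowsky_preimage hR (z := ⟨x, y⟩) hy.ne'
  have hRc : (R : ℂ) ≠ 0 := by exact_mod_cast hR.ne'
  have hsq : 0 < Complex.normSq r := Complex.normSq_pos.mpr hr0
  have hsq1 : Complex.normSq r < 1 := by
    rw [Complex.normSq_eq_norm_sq]; nlinarith [norm_nonneg r]
  have hxr : x = R / 2 * (r.re + r.re / Complex.normSq r) := by
    have h := congrArg Complex.re hz
    have h2 : (R / 2 : ℂ) = ((R / 2 : ℝ) : ℂ) := by push_cast; rfl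
    rw [h2, Complex.re_ofReal_mul] at h
    simpa using h
  have hre : 0 < r.re := by
    have h1 : x = r.re * (R / 2 * (1 + 1 / Complex.normSq r)) := by rw [hxr]; ring
    rw [h1] at hx
    exact (pos_iff_pos_of_mul_pos hx).mpr (by positivity)
  have hne : ∀ θ : ℝ, (⟨x, y⟩ : ℂ) - R * Real.cos θ ≠ 0 := fun θ h ↦ by
    have := congrArg Complex.im h
    simp at this
    exact hy.ne' this
  have hint : ∫ θ in (0 : ℝ)..π, (Real.sin θ : ℂ) ^ 2 / ((⟨x, y⟩ : ℂ) - R * Real.cos θ) =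
      π * r / R := by
    have hpt : ∀ θ : ℝ, (Real.sin θ : ℂ) ^ 2 / ((⟨x, y⟩ : ℂ) - R * Real.cos θ) =
        2 * r / R * ((Real.sin θ : ℂ) ^ 2 / (1 - 2 * r * (Real.cos θ : ℂ) + r ^ 2)) := by
      intro θ
      have hfac : (⟨x, y⟩ : ℂ) - R * Real.cos θ =
          R / (2 * r) * (1 - 2 * r * (Real.cos θ : ℂ) + r ^ 2) := by
        rw [hz]; field_simp; ring
      have h0 : 1 - 2 * r * (Real.cos θ : ℂ) + r ^ 2 ≠ 0 := by
        intro h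
        exact hne θ (by rw [hfac, h, mul_zero])
      rw [hfac]
      field_simp
    simp_rw [hpt]
    rw [intervalIntegral.integral_const_mul, integral_sin_sq_div_one_sub_two_mul_cos_add_sq hr1]
    field_simp
  have hcont : Continuous fun θ : ℝ ↦
      (Real.sin θ : ℂ) ^ 2 / ((⟨x, y⟩ : ℂ) - R * Real.cos θ) :=
    Continuous.div (by fun_prop) (by fun_prop) hne
  have hreal : ∫ θ in (0 : ℝ)..π, (x - R * Real.cos θ) / ((x - R * Real.cos θ) ^ 2 + y ^ 2) *
      Real.sin θ ^ 2 = π * r.re / R := by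
    have h := Complex.reCLM.intervalIntegral_comp_comm (hcont.intervalIntegrable (μ := volume) 0 π)
    rw [hint] at h
    have h3 : (π * r / R : ℂ) = ((π / R : ℝ) : ℂ) * r := by push_cast; ring
    rw [h3, Complex.reCLM_apply, Complex.re_ofReal_mul] at h
    rw [show π * r.re / R = π / R * r.re by ring, ← h]
    refine intervalIntegral.integral_congr fun θ _ ↦ ?_
    have h4 : ((Real.sin θ : ℂ) ^ 2) = ((Real.sin θ ^ 2 : ℝ) : ℂ) := by push_cast; rfl
    simp only [Complex.reCLM_apply]
    rw [h4, div_eq_mul_inv (_ : ℂ), Complex.re_ofReal_mul, Complex.inv_re, Complex.normSq_apply]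
    simp only [Complex.sub_re, Complex.sub_im, Complex.re_ofReal_mul, Complex.im_ofReal_mul,
      Complex.ofReal_re, Complex.ofReal_im]
    ring
  rw [hreal, hxr]
  have h5 : 1 < 1 / Complex.normSq r := by rw [lt_div_iff₀ hsq]; linarith
  have h6 : π * (R / 2 * (r.re + r.re / Complex.normSq r)) / R ^ 2 - π * r.re / R =
      π * r.re / (2 * R) * (1 / Complex.normSq r - 1) := by
    field_simp; ring
  have : 0 < π * r.re / (2 * R) * (1 / Complex.normSq r - 1) :=
    mul_pos (by positivity) (by linarith)
  linarith

/-- The logarithmic potential of the semicircle law in angular coordinates. -/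
theorem integral_log_mul_rhoSC {τ : ℝ} (hτ : 0 ≤ τ) (x : ℝ) {y : ℝ} (hy : 0 < y) :
    ∫ t : ℝ, Real.log ((x - t) ^ 2 + y ^ 2) * rhoSC τ t =
      ∫ θ in (0 : ℝ)..π, Real.log ((x - √(2 * (1 + τ)) * Real.cos θ) ^ 2 + y ^ 2) *
        (2 / π * Real.sin θ ^ 2) := by
  set R := √(2 * (1 + τ)) with hRdef
  have hR : 0 < R := Real.sqrt_pos.mpr (by linarith)
  have hR2 : R ^ 2 = 2 * (1 + τ) := Real.sq_sqrt (by linarith)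
  set G : ℝ → ℝ := fun t ↦
    Real.log ((x - t) ^ 2 + y ^ 2) * (√(R ^ 2 - t ^ 2) / (π * (1 + τ))) with hG
  have hGc : Continuous G := by
    have : ∀ t : ℝ, (x - t) ^ 2 + y ^ 2 ≠ 0 := fun t ↦ by positivity
    fun_prop (disch := assumption)
  have h1 : ∫ t : ℝ, Real.log ((x - t) ^ 2 + y ^ 2) * rhoSC τ t = ∫ t in -R..R, G t := by
    rw [intervalIntegral.integral_of_le (by linarith), ← integral_Icc_eq_integral_Ioc,
      ← integral_indicator measurableSet_Icc]
    congr 1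
    ext t
    have hiff : t ∈ Set.Icc (-R) R ↔ t ^ 2 ≤ 2 * (1 + τ) := by
      rw [← hR2, Set.mem_Icc, sq_le_sq, abs_of_pos hR, abs_le]
    by_cases ht : t ∈ Set.Icc (-R) R
    · rw [Set.indicator_of_mem ht, rhoSC, if_pos (hiff.mp ht), hG, hR2]
    · rw [Set.indicator_of_notMem ht, rhoSC, if_neg (fun h ↦ ht (hiff.mpr h)), mul_zero]
  have h2 := intervalIntegral.integral_comp_mul_deriv (a := 0) (b := π)
    (f := fun θ ↦ R * Real.cos θ) (f' := fun θ ↦ R * (-Real.sin θ)) (g := G)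
    (fun θ _ ↦ (Real.hasDerivAt_cos θ).const_mul R) (by fun_prop) hGc
  rw [h1, intervalIntegral.integral_symm]
  simp only [Real.cos_zero, Real.cos_pi, mul_one, mul_neg_one] at h2
  rw [← h2, ← intervalIntegral.integral_neg]
  refine intervalIntegral.integral_congr fun θ hθ ↦ ?_
  rw [Set.uIcc_of_le Real.pi_nonneg] at hθ
  have hs : 0 ≤ Real.sin θ := Real.sin_nonneg_of_mem_Icc hθ
  have hsqrt : √(R ^ 2 - (R * Real.cos θ) ^ 2) = R * Real.sin θ := by
    rw [show R ^ 2 - (R * Real.cos θ) ^ 2 = (R * Real.sin θ) ^ 2 by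
      linear_combination (-R ^ 2) * Real.sin_sq_add_cos_sq θ]
    exact Real.sqrt_sq (by positivity)
  have hτ' : 1 + τ ≠ 0 := by positivity
  simp only [hG, Function.comp, hsqrt]
  field_simp
  rw [hR2]
  ring

/-- Differentiation of the angular logarithmic potential under the integral sign. -/
theorem hasDerivAt_integral_log_angular (R x : ℝ) {y : ℝ} (hy : 0 < y) :
    HasDerivAt (fun x ↦ ∫ θ in (0 : ℝ)..π,
        Real.log ((x - R * Real.cos θ) ^ 2 + y ^ 2) * (2 / π * Real.sin θ ^ 2))
      (4 / π * ∫ θ in (0 : ℝ)..π, (x - R * Real.cos θ) / ((x - R * Real.cos θ) ^ 2 + y ^ 2) *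
        Real.sin θ ^ 2) x := by
  have hne : ∀ x θ : ℝ, (x - R * Real.cos θ) ^ 2 + y ^ 2 ≠ 0 := fun x θ ↦ by positivity
  have hF : ∀ x : ℝ, Continuous fun θ ↦
      Real.log ((x - R * Real.cos θ) ^ 2 + y ^ 2) * (2 / π * Real.sin θ ^ 2) := fun x ↦ by
    have := hne x
    fun_prop (disch := assumption)
  have hF' : Continuous fun θ ↦ 4 / π *
      ((x - R * Real.cos θ) / ((x - R * Real.cos θ) ^ 2 + y ^ 2) * Real.sin θ ^ 2) := by
    have := hne x
    fun_prop (disch := assumption)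
  rw [← intervalIntegral.integral_const_mul]
  refine (intervalIntegral.hasDerivAt_integral_of_dominated_loc_of_deriv_le
    (F' := fun x θ ↦ 4 / π *
      ((x - R * Real.cos θ) / ((x - R * Real.cos θ) ^ 2 + y ^ 2) * Real.sin θ ^ 2))
    (bound := fun _ ↦ 4 / π * (1 / y)) Filter.univ_mem
    (.of_forall fun x ↦ (hF x).aestronglyMeasurable) ((hF x).intervalIntegrable _ _)
    hF'.aestronglyMeasurable (.of_forall fun θ _ x _ ↦ ?_) (by simp)
    (.of_forall fun θ _ x _ ↦ ?_)).2
  · have hpos : 0 < (x - R * Real.cos θ) ^ 2 + y ^ 2 := by positivity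
    rw [Real.norm_eq_abs, abs_mul, abs_of_pos (by positivity : 0 < 4 / π), abs_mul, abs_div,
      abs_of_pos hpos, abs_of_nonneg (sq_nonneg (Real.sin θ))]
    gcongr
    refine (mul_le_of_le_one_right (by positivity) (Real.sin_sq_le_one θ)).trans ?_
    rw [div_le_div_iff₀ hpos hy, one_mul]
    nlinarith [sq_nonneg (|x - R * Real.cos θ| - y), sq_abs (x - R * Real.cos θ),
      abs_nonneg (x - R * Real.cos θ)]
  · have h1 : HasDerivAt (fun x ↦ (x - R * Real.cos θ) ^ 2 + y ^ 2)
        (2 * (x - R * Real.cos θ)) x := by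
      simpa using (((hasDerivAt_id x).sub_const (R * Real.cos θ)).pow 2).add_const (y ^ 2)
    refine ((h1.log (hne x θ)).mul_const (2 / π * Real.sin θ ^ 2)).congr_deriv ?_
    ring

theorem Qpot_neg (τ : ℝ) (n : ℕ) (x y : ℝ) : Qpot τ n (-x) y = Qpot τ n x y := by
  have h : ∫ t : ℝ, Real.log ((-x - t) ^ 2 + y ^ 2) * rhoSC τ t =
      ∫ t : ℝ, Real.log ((x - t) ^ 2 + y ^ 2) * rhoSC τ t := by
    rw [← integral_neg_eq_self]
    refine integral_congr_ae (.of_forall fun t ↦ ?_)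
    simp only [rhoSC, neg_sq]
    rw [show (-x - -t) ^ 2 = (x - t) ^ 2 by ring]
  simp only [Qpot, h, neg_sq]

theorem hasDerivAt_Qpot {τ : ℝ} (hτ : 0 ≤ τ) (n : ℕ) (x : ℝ) {y : ℝ} (hy : 0 < y) :
    HasDerivAt (fun x ↦ Qpot τ n x y)
      (2 * x / (1 + τ) - 4 / π * ∫ θ in (0 : ℝ)..π,
        (x - √(2 * (1 + τ)) * Real.cos θ) / ((x - √(2 * (1 + τ)) * Real.cos θ) ^ 2 + y ^ 2) *
          Real.sin θ ^ 2) x := by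
  simp only [Qpot, integral_log_mul_rhoSC hτ _ hy]
  refine HasDerivAt.sub ?_ (hasDerivAt_integral_log_angular _ x hy)
  refine HasDerivAt.const_add _ ?_
  refine HasDerivAt.div_const ?_ _
  simpa using ((hasDerivAt_id x).pow 2).sub_const (y ^ 2)

theorem deriv_Qpot_pos {τ : ℝ} (hτ : 0 ≤ τ) (n : ℕ) {x y : ℝ} (hx : 0 < x) (hy : 0 < y) :
    0 < deriv (fun x ↦ Qpot τ n x y) x := by
  rw [(hasDerivAt_Qpot hτ n x hy).deriv]
  have hR : 0 < √(2 * (1 + τ)) := Real.sqrt_pos.mpr (by linarith)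
  have hR2 : √(2 * (1 + τ)) ^ 2 = 2 * (1 + τ) := Real.sq_sqrt (by linarith)
  have h := mul_lt_mul_of_pos_left (integral_semicircle_kernel_lt hR hx hy)
    (by positivity : 0 < 4 / π)
  have h2 : 4 / π * (π * x / √(2 * (1 + τ)) ^ 2) = 2 * x / (1 + τ) := by
    rw [hR2]; field_simp; ring
  linarith

/-- For fixed `y > 0`, the potential is even in `x`, has positive `x`-derivative for
`x > 0`, and attains its minimum over `x` at `x = 0`. -/
theorem Qpot_even_and_min_at_zero (τ : ℝ) (hτ0 : 0 ≤ τ) (hτ1 : τ < 1)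
    (n : ℕ) (hn : 1 ≤ n) (y : ℝ) (hy : 0 < y) :
    (∀ x : ℝ, Qpot τ n (-x) y = Qpot τ n x y) ∧
    (∀ x : ℝ, 0 < x → 0 < deriv (fun x => Qpot τ n x y) x) ∧
    (∀ x : ℝ, Qpot τ n 0 y ≤ Qpot τ n x y) := by
  refine ⟨fun x ↦ Qpot_neg τ n x y, fun x hx ↦ deriv_Qpot_pos hτ0 n hx hy, fun x ↦ ?_⟩
  have hmono : MonotoneOn (fun x ↦ Qpot τ n x y) (Set.Ici 0) := by
    refine monotoneOn_of_deriv_nonneg (convex_Ici 0)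
      (fun x _ ↦ (hasDerivAt_Qpot hτ0 n x hy).continuousAt.continuousWithinAt)
      (fun x _ ↦ (hasDerivAt_Qpot hτ0 n x hy).differentiableAt.differentiableWithinAt)
      fun x hx ↦ ?_
    rw [interior_Ici] at hx
    exact (deriv_Qpot_pos hτ0 n hx hy).le
  rcases le_total 0 x with hx | hx
  · exact hmono Set.self_mem_Ici hx hx
  · rw [← Qpot_neg τ n x]
    exact hmono Set.self_mem_Ici (neg_nonneg.mpr hx) (neg_nonneg.mpr hx)
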